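/- arXiv:2302.04148 — 3 statements merged into one kernel-verified Lean document; each statement's English description precedes it below -/
import Mathlib

section
/- Let n ≥ 1, ε ∈ (0,1), and define f_{n,d}(ε) = (1 − (1 − ε²)^{n−1})^{d(d−1)/2}. If d ≥ 2 satisfies d ≥ (1/(1 − ε²))^{(3/5)(n−1)}, then f_{n,d}(ε) ≤ exp( −((d−1)²/2) · (1 − ε²)^{n−1} ) ≤ exp( −((d−1)/d)² · d^{1/3} / 2 ). -/
/-- `(1 - x)^k ≤ exp (-(k x))` for `x ≤ 1`. -/
theorem one_sub_pow_le_exp_neg_mul {x : ℝ} (hx : x ≤ 1) (k : ℕ) :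
    (1 - x) ^ k ≤ Real.exp (-(k * x)) := by
  calc (1 - x) ^ k ≤ Real.exp (-x) ^ k :=
        pow_le_pow_left₀ (sub_nonneg.2 hx) (Real.one_sub_le_exp_neg x) k
    _ = Real.exp (-(k * x)) := by rw [← Real.exp_nat_mul, mul_neg]

/-- If `(1/x)^(3/5) ≤ d` then `d^(1/3) ≤ d² x`. -/
theorem rpow_one_third_le_sq_mul {x d : ℝ} (hx : 0 < x) (hd : 0 < d)
    (h : (1 / x) ^ (3 / 5 : ℝ) ≤ d) : d ^ ((1 : ℝ) / 3) ≤ d ^ 2 * x := by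
  have hinv : 1 / x ≤ d ^ (5 / 3 : ℝ) := by
    have h' := Real.rpow_le_rpow (by positivity) h (by norm_num : (0 : ℝ) ≤ 5 / 3)
    rw [← Real.rpow_mul (by positivity)] at h'
    norm_num at h' ⊢
    exact h'
  have hsq : d ^ 2 = d ^ ((1 : ℝ) / 3) * d ^ (5 / 3 : ℝ) := by
    rw [← Real.rpow_add hd, ← Real.rpow_natCast]
    norm_num
  rw [hsq, mul_assoc]
  exact le_mul_of_one_le_right (by positivity) ((div_le_iff₀ hx).1 hinv)


/-- For `n ≥ 1`, `ε ∈ (0,1)` and `d ≥ 2` with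
`d ≥ (1/(1-ε²))^((3/5)(n-1))`, one has
`f_{n,d}(ε) = (1-(1-ε²)^(n-1))^(d(d-1)/2) ≤ exp(-((d-1)²/2)(1-ε²)^(n-1))
≤ exp(-((d-1)/d)² d^(1/3)/2)`. -/
theorem f_upper_bound (n d : ℕ) (hn : 1 ≤ n) (hd : 2 ≤ d)
    (ε : ℝ) (hε : ε ∈ Set.Ioo (0 : ℝ) 1)
    (hdc : (1 / (1 - ε ^ 2)) ^ ((3 / 5 : ℝ) * ((n : ℝ) - 1)) ≤ (d : ℝ)) :
    (1 - (1 - ε ^ 2) ^ (n - 1)) ^ (d * (d - 1) / 2)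
        ≤ Real.exp (-(((d : ℝ) - 1) ^ 2 / 2) * (1 - ε ^ 2) ^ (n - 1)) ∧
    Real.exp (-(((d : ℝ) - 1) ^ 2 / 2) * (1 - ε ^ 2) ^ (n - 1))
        ≤ Real.exp (-((((d : ℝ) - 1) / d) ^ 2 * (d : ℝ) ^ ((1 : ℝ) / 3) / 2)) := by
  have hy : 0 < 1 - ε ^ 2 := by nlinarith [hε.1, hε.2]
  have hpow : (1 / (1 - ε ^ 2)) ^ ((3 / 5 : ℝ) * ((n : ℝ) - 1))
      = (1 / (1 - ε ^ 2) ^ (n - 1)) ^ (3 / 5 : ℝ) := by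
    rw [mul_comm, Real.rpow_mul (by positivity), ← Nat.cast_pred hn, Real.rpow_natCast,
      one_div_pow]
  rw [hpow] at hdc
  have hx : 0 < (1 - ε ^ 2) ^ (n - 1) := by positivity
  have hx1 : (1 - ε ^ 2) ^ (n - 1) ≤ 1 := pow_le_one₀ hy.le (by nlinarith [sq_nonneg ε])
  generalize (1 - ε ^ 2) ^ (n - 1) = x at *
  have hd2 : (2 : ℝ) ≤ d := by exact_mod_cast hd
  have hd0 : (0 : ℝ) < d := by linarith
  constructor
  · refine (one_sub_pow_le_exp_neg_mul hx1 _).trans (Real.exp_le_exp.2 ?_)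
    have hk : ((d * (d - 1) / 2 : ℕ) : ℝ) = d * ((d : ℝ) - 1) / 2 := by
      rw [Nat.cast_div (even_iff_two_dvd.1 (Nat.even_mul_pred_self d)) (by norm_num),
        Nat.cast_mul, Nat.cast_pred (by omega)]
      norm_num
    rw [hk, neg_mul, neg_le_neg_iff]
    exact mul_le_mul_of_nonneg_right (by nlinarith) hx.le
  · rw [Real.exp_le_exp, neg_mul, neg_le_neg_iff]
    calc (((d : ℝ) - 1) / d) ^ 2 * (d : ℝ) ^ ((1 : ℝ) / 3) / 2
        ≤ (((d : ℝ) - 1) / d) ^ 2 * ((d : ℝ) ^ 2 * x) / 2 := by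
          gcongr
          exact rpow_one_third_le_sq_mul hx hd0 hdc
      _ = ((d : ℝ) - 1) ^ 2 / 2 * x := by field_simp
end

section
/- Let d ≥ 1 be an integer, let k be an integer with 1 ≤ k ≤ d, and let x be a real number with 0 ≤ x < d^{−5/3}. Then 1 ≤ (1 − x)^k / (1 − kx) ≤ 1 + (k(k−1)/2) · x² / (1 − x^{2/5}). -/
/-- The second-order Bonferroni-type upper bound for `(1 - x) ^ k`. -/
theorem one_sub_pow_le_quadratic {x : ℝ} (hx0 : 0 ≤ x) (hx1 : x ≤ 1) (k : ℕ) :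
    (1 - x) ^ k ≤ 1 - (k : ℝ) * x + ((k : ℝ) * ((k : ℝ) - 1) / 2) * x ^ 2 := by
  induction k with
  | zero => simp
  | succ k ih =>
    have hC : (0 : ℝ) ≤ (k : ℝ) * ((k : ℝ) - 1) / 2 := by
      rcases Nat.eq_zero_or_pos k with rfl | hk
      · simp
      · have : (1 : ℝ) ≤ k := by exact_mod_cast hk
        have := sub_nonneg.2 this
        positivity
    have hmul := mul_le_mul_of_nonneg_right ih (sub_nonneg.2 hx1)
    have hcube := mul_nonneg hC (pow_nonneg hx0 3)
    rw [pow_succ]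
    push_cast
    linarith

/-- If `0 ≤ x < d ^ (-5/3)` then `d * x ≤ x ^ (2/5)`. -/
theorem mul_le_rpow_two_fifths {d x : ℝ} (hd : 0 < d) (hx0 : 0 ≤ x)
    (hxd : x < d ^ (-(5 / 3 : ℝ))) : d * x ≤ x ^ (2 / 5 : ℝ) := by
  have hroot : x ^ (3 / 5 : ℝ) ≤ d⁻¹ := by
    calc x ^ (3 / 5 : ℝ) ≤ (d ^ (-(5 / 3 : ℝ))) ^ (3 / 5 : ℝ) :=
          Real.rpow_le_rpow hx0 hxd.le (by norm_num)
      _ = d⁻¹ := by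
          rw [← Real.rpow_mul hd.le, ← Real.rpow_neg_one]
          norm_num
  have hsplit : x ^ (3 / 5 : ℝ) * x ^ (2 / 5 : ℝ) = x := by
    rw [← Real.rpow_add' hx0 (by norm_num)]
    norm_num
  calc d * x = d * x ^ (3 / 5 : ℝ) * x ^ (2 / 5 : ℝ) := by rw [mul_assoc, hsplit]
    _ ≤ d * d⁻¹ * x ^ (2 / 5 : ℝ) := by gcongr
    _ = x ^ (2 / 5 : ℝ) := by rw [mul_inv_cancel₀ hd.ne', one_mul]

/-- For integers `1 ≤ k ≤ d` and a real `0 ≤ x < d^(-5/3)`,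
`1 ≤ (1-x)^k / (1-kx) ≤ 1 + (k(k-1)/2) x² / (1 - x^(2/5))`. -/
theorem one_le_pow_div_and_le (d k : ℕ) (hd : 1 ≤ d) (hk1 : 1 ≤ k) (hkd : k ≤ d)
    (x : ℝ) (hx0 : 0 ≤ x) (hxd : x < (d : ℝ) ^ (-(5 / 3 : ℝ))) :
    1 ≤ (1 - x) ^ k / (1 - (k : ℝ) * x) ∧
    (1 - x) ^ k / (1 - (k : ℝ) * x)
      ≤ 1 + ((k : ℝ) * ((k : ℝ) - 1) / 2) * x ^ 2 / (1 - x ^ ((2 / 5 : ℝ))) := by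
  have hk : (1 : ℝ) ≤ k := by exact_mod_cast hk1
  have hkd' : (k : ℝ) ≤ d := by exact_mod_cast hkd
  have hd' : (1 : ℝ) ≤ d := by exact_mod_cast hd
  have hx1 : x < 1 :=
    hxd.trans_le (Real.rpow_le_one_of_one_le_of_nonpos hd' (by norm_num))
  have hkx : (k : ℝ) * x ≤ x ^ (2 / 5 : ℝ) :=
    (mul_le_mul_of_nonneg_right hkd' hx0).trans
      (mul_le_rpow_two_fifths (by linarith) hx0 hxd)
  have hlt : x ^ (2 / 5 : ℝ) < 1 := Real.rpow_lt_one hx0 hx1 (by norm_num)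
  have hpos : 0 < 1 - (k : ℝ) * x := by linarith
  constructor
  · rw [one_le_div hpos]
    have := one_add_mul_le_pow (a := -x) (by linarith) k
    simpa [sub_eq_add_neg] using this
  · have hC : 0 ≤ ((k : ℝ) * ((k : ℝ) - 1) / 2) * x ^ 2 := by
      have := sub_nonneg.2 hk
      positivity
    calc (1 - x) ^ k / (1 - (k : ℝ) * x)
        ≤ (1 - (k : ℝ) * x + ((k : ℝ) * ((k : ℝ) - 1) / 2) * x ^ 2) / (1 - (k : ℝ) * x) := by
          gcongr
          exact one_sub_pow_le_quadratic hx0 hx1.le k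
      _ = 1 + ((k : ℝ) * ((k : ℝ) - 1) / 2) * x ^ 2 / (1 - (k : ℝ) * x) := by
          rw [add_div, div_self hpos.ne']
      _ ≤ 1 + ((k : ℝ) * ((k : ℝ) - 1) / 2) * x ^ 2 / (1 - x ^ (2 / 5 : ℝ)) := by
          gcongr
end

section
/- Let n ≥ 2, ε ∈ (0,1), and define f_{n,d}(ε) = (1 − (1 − ε²)^{n−1})^{d(d−1)/2} and g_{n,d}(ε) = ∏_{k=1}^{d−1} (1 − k(1 − ε²)^{n−1}). If d ≥ 1 satisfies d ≤ (1/(1 − ε²))^{(3/5)(n−1)}, then |f_{n,d}(ε) − g_{n,d}(ε)| ≤ (1 − ε²)^{(n−1)/5} / ( 6 (1 − (1 − ε²)^{(2/5)(n−1)}) ). -/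
/-- Second-order Bonferroni upper bound for `(1 - x) ^ k`. -/
lemma one_sub_pow_le_second_order {x : ℝ} (h0 : 0 ≤ x) (h1 : x ≤ 1) (k : ℕ) :
    (1 - x) ^ (k + 1) ≤ 1 - (k + 1) * x + (k + 1) * k / 2 * x ^ 2 := by
  induction k with
  | zero => simp
  | succ k ih =>
    have h := mul_le_mul_of_nonneg_right ih (sub_nonneg.2 h1)
    have hx : 0 ≤ ((k : ℝ) + 1) * k / 2 * x ^ 3 := by positivity
    rw [pow_succ]
    push_cast
    nlinarith

lemma succ_mul_div_two_succ (m : ℕ) :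
    (m + 2) * (m + 1) / 2 = (m + 1) * m / 2 + (m + 1) := by
  rw [← Nat.add_mul_div_left _ _ two_pos]
  congr 1
  ring

/-- The product `∏ (1 - k x)` lies below the corresponding power of `1 - x`, with an error
of at most `m ^ 3 x ^ 2 / 6`. -/
lemma one_sub_pow_sub_prod_mem_Icc {x : ℝ} (h0 : 0 ≤ x) (h1 : x ≤ 1) (m : ℕ)
    (hm : (m : ℝ) * x ≤ 1) :
    (1 - x) ^ ((m + 1) * m / 2) - ∏ k ∈ Finset.Icc 1 m, (1 - (k : ℝ) * x)
      ∈ Set.Icc 0 ((m : ℝ) ^ 3 / 6 * x ^ 2) := by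
  induction m with
  | zero => simp
  | succ m ih =>
    push_cast at hm
    obtain ⟨hl, hu⟩ := ih (by linarith)
    rw [Finset.prod_Icc_succ_top (by omega), succ_mul_div_two_succ, pow_add]
    have hQ0 : 0 ≤ (1 - x) ^ ((m + 1) * m / 2) := pow_nonneg (by linarith) _
    have hQ1 : (1 - x) ^ ((m + 1) * m / 2) ≤ 1 := pow_le_one₀ (by linarith) (by linarith)
    have ha := one_sub_pow_le_second_order h0 h1 m
    have hb : 1 - ((m : ℝ) + 1) * x ≤ (1 - x) ^ (m + 1) := by
      have h := one_add_mul_le_pow (a := -x) (by linarith) (m + 1)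
      push_cast at h
      rw [← sub_eq_add_neg] at h
      linarith
    push_cast
    generalize (1 - x) ^ ((m + 1) * m / 2) = Q at *
    generalize ∏ k ∈ Finset.Icc 1 m, (1 - (k : ℝ) * x) = P at *
    generalize (1 - x) ^ (m + 1) = a at *
    have hsplit : Q * a - P * (1 - ((m : ℝ) + 1) * x)
        = Q * (a - (1 - ((m : ℝ) + 1) * x)) + (Q - P) * (1 - ((m : ℝ) + 1) * x) := by ring
    have hmx : 0 ≤ ((m : ℝ) + 1) * x := by positivity
    rw [hsplit]
    constructor
    · exact add_nonneg (mul_nonneg hQ0 (by linarith)) (mul_nonneg hl (by linarith))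
    · have e1 := mul_le_of_le_one_left (sub_nonneg.2 hb) hQ1
      have e2 := mul_le_of_le_one_right hl (by linarith : 1 - ((m : ℝ) + 1) * x ≤ 1)
      have e3 : 0 ≤ x ^ 2 := by positivity
      nlinarith

/-- For `n ≥ 2`, `ε ∈ (0,1)` and `d ≥ 1` with
`d ≤ (1/(1-ε²))^((3/5)(n-1))`, the bounds
`f_{n,d}(ε) = (1-(1-ε²)^(n-1))^(d(d-1)/2)` and
`g_{n,d}(ε) = ∏_{k=1}^{d-1} (1-k(1-ε²)^(n-1))` satisfy
`|f_{n,d}(ε) - g_{n,d}(ε)| ≤ (1-ε²)^((n-1)/5) / (6(1-(1-ε²)^((2/5)(n-1))))`. -/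
theorem f_sub_g_bound (n d : ℕ) (hn : 2 ≤ n) (hd : 1 ≤ d)
    (ε : ℝ) (hε : ε ∈ Set.Ioo (0 : ℝ) 1)
    (hdc : (d : ℝ) ≤ (1 / (1 - ε ^ 2)) ^ ((3 / 5 : ℝ) * ((n : ℝ) - 1))) :
    |(1 - (1 - ε ^ 2) ^ (n - 1)) ^ (d * (d - 1) / 2)
        - ∏ k ∈ Finset.Icc 1 (d - 1), (1 - (k : ℝ) * (1 - ε ^ 2) ^ (n - 1))|
      ≤ (1 - ε ^ 2) ^ (((n : ℝ) - 1) / 5)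
          / (6 * (1 - (1 - ε ^ 2) ^ ((2 / 5 : ℝ) * ((n : ℝ) - 1)))) := by
  obtain ⟨hε0, hε1⟩ := hε
  have hr0 : 0 < 1 - ε ^ 2 := by nlinarith
  have hr1 : 1 - ε ^ 2 < 1 := by nlinarith
  have hn' : (0 : ℝ) < (n : ℝ) - 1 := by
    have : (2 : ℝ) ≤ n := by exact_mod_cast hn
    linarith
  generalize 1 - ε ^ 2 = r at *
  have ht0 : 0 < r ^ (((n : ℝ) - 1) / 5) := Real.rpow_pos_of_pos hr0 _
  have ht1 : r ^ (((n : ℝ) - 1) / 5) < 1 := Real.rpow_lt_one hr0.le hr1 (by positivity)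
  have hpow (j : ℕ) : r ^ (((n : ℝ) - 1) / 5 * j) = (r ^ (((n : ℝ) - 1) / 5)) ^ j := by
    rw [Real.rpow_mul hr0.le, Real.rpow_natCast]
  have hx : r ^ (n - 1) = (r ^ (((n : ℝ) - 1) / 5)) ^ 5 := by
    rw [← hpow, ← Real.rpow_natCast, Nat.cast_sub (by omega)]
    congr 1
    push_cast
    ring
  have h2 : r ^ ((2 / 5 : ℝ) * ((n : ℝ) - 1)) = (r ^ (((n : ℝ) - 1) / 5)) ^ 2 := by
    rw [← hpow]
    congr 1
    push_cast
    ring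
  have h3 : r ^ ((3 / 5 : ℝ) * ((n : ℝ) - 1)) = (r ^ (((n : ℝ) - 1) / 5)) ^ 3 := by
    rw [← hpow]
    congr 1
    push_cast
    ring
  rw [one_div, Real.inv_rpow hr0.le, h3] at hdc
  rw [hx, h2]
  generalize r ^ (((n : ℝ) - 1) / 5) = t at *
  obtain ⟨m, rfl⟩ : ∃ m, d = m + 1 := ⟨d - 1, by omega⟩
  have hmt : (m : ℝ) * t ^ 3 ≤ 1 := by
    rw [← le_div_iff₀ (by positivity), one_div]
    push_cast at hdc
    linarith
  have ht2 : t ^ 2 < 1 := pow_lt_one₀ ht0.le ht1 two_ne_zero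
  have hmx : (m : ℝ) * t ^ 5 ≤ 1 := by
    calc (m : ℝ) * t ^ 5 = (m * t ^ 3) * t ^ 2 := by ring
      _ ≤ 1 := mul_le_one₀ hmt (by positivity) ht2.le
  obtain ⟨hl, hu⟩ := one_sub_pow_sub_prod_mem_Icc (by positivity)
    (pow_le_one₀ ht0.le ht1.le : t ^ 5 ≤ 1) m hmx
  rw [Nat.add_sub_cancel, abs_of_nonneg hl]
  calc _ ≤ (m : ℝ) ^ 3 / 6 * (t ^ 5) ^ 2 := hu
    _ = (m * t ^ 3) ^ 3 * (t / 6) := by ring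
    _ ≤ t / 6 := mul_le_of_le_one_left (by positivity) (pow_le_one₀ (by positivity) hmt)
    _ ≤ t / (6 * (1 - t ^ 2)) := by
      apply div_le_div_of_nonneg_left ht0.le (by linarith)
      nlinarith [sq_nonneg t]
end
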